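/- Let the feasible semidefinite system (P_SD) satisfy the assumption that Z = diag(I_r, 0) is a maximum rank slack. Then (P_SD) is well behaved if and only if both Good conditions hold. Good condition 1: there exists a positive definite (n−r)×(n−r) matrix U with A_i • diag(0, U) = 0 for all i. Good condition 2: every linear combination V = Σ λ_i A_i whose lower-right (n−r)×(n−r) block is zero has zero upper-right r×(n−r) block. -/

import Mathlib

open Matrix

/-- Trace inner product `S • T = trace(ST)` of square real matrices. -/
noncomputable def ip {k : ℕ} (S T : Matrix (Fin k) (Fin k) ℝ) : ℝ :=
  Matrix.trace (S * T)

/-- `x` is feasible for the semidefinite system `∑ xᵢ Aᵢ ⪯ B`. -/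
def IsFeasible {n m : ℕ} (A : Fin m → Matrix (Fin n) (Fin n) ℝ)
    (B : Matrix (Fin n) (Fin n) ℝ) (x : Fin m → ℝ) : Prop :=
  (B - ∑ i, x i • A i).PosSemidef

/-- The set of primal objective values `∑ cᵢ xᵢ` over feasible `x`. -/
def PrimalVals {n m : ℕ} (A : Fin m → Matrix (Fin n) (Fin n) ℝ)
    (B : Matrix (Fin n) (Fin n) ℝ) (c : Fin m → ℝ) : Set ℝ :=
  {s | ∃ x : Fin m → ℝ, IsFeasible A B x ∧ s = ∑ i, c i * x i}

/-- The system `∑ xᵢ Aᵢ ⪯ B` is badly behaved: for some `c` the primal optimal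
value is finite (i.e. is a least upper bound `v`), but no dual feasible `Y`
achieves value `v`. -/
def BadlyBehaved {n m : ℕ} (A : Fin m → Matrix (Fin n) (Fin n) ℝ)
    (B : Matrix (Fin n) (Fin n) ℝ) : Prop :=
  ∃ (c : Fin m → ℝ) (v : ℝ), IsLUB (PrimalVals A B c) v ∧
    ¬ ∃ Y : Matrix (Fin n) (Fin n) ℝ,
        Y.PosSemidef ∧ (∀ i, ip (A i) Y = c i) ∧ ip B Y = v

/-- `Zmat n r = diag(I_r, 0)`. -/
def Zmat (n r : ℕ) : Matrix (Fin n) (Fin n) ℝ :=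
  Matrix.of fun i j => if i = j ∧ (i : ℕ) < r then (1 : ℝ) else 0

/-- `Zmat n r` is a maximum rank slack of `∑ xᵢ Aᵢ ⪯ B`:
it is a slack and every slack has rank at most `r`. -/
def MaxRankSlack {n m : ℕ} (A : Fin m → Matrix (Fin n) (Fin n) ℝ)
    (B : Matrix (Fin n) (Fin n) ℝ) (r : ℕ) : Prop :=
  (∃ x : Fin m → ℝ, B - ∑ i, x i • A i = Zmat n r) ∧
  ∀ x : Fin m → ℝ, IsFeasible A B x → (B - ∑ i, x i • A i).rank ≤ r

/-- Lower-right `(n-r) × (n-r)` block. -/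
def block22 {n : ℕ} (r : ℕ) (h : r ≤ n) (V : Matrix (Fin n) (Fin n) ℝ) :
    Matrix (Fin (n - r)) (Fin (n - r)) ℝ :=
  Matrix.of fun i j => V ⟨r + i.1, by omega⟩ ⟨r + j.1, by omega⟩

/-- Upper-right `r × (n-r)` block. -/
def block12 {n : ℕ} (r : ℕ) (h : r ≤ n) (V : Matrix (Fin n) (Fin n) ℝ) :
    Matrix (Fin r) (Fin (n - r)) ℝ :=
  Matrix.of fun i j => V ⟨i.1, by omega⟩ ⟨r + j.1, by omega⟩

/-- The column space (range space) of a matrix. -/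
def colSpace {p q : ℕ} (M : Matrix (Fin p) (Fin q) ℝ) : Submodule ℝ (Fin p → ℝ) :=
  LinearMap.range M.mulVecLin

/-- The "Bad condition": some linear combination `V` of the `Aᵢ` has `V₂₂ ⪰ 0`
and `ℛ(V₁₂ᵀ) ⊄ ℛ(V₂₂)`. -/
def BadCond {n m : ℕ} (A : Fin m → Matrix (Fin n) (Fin n) ℝ) (r : ℕ) (h : r ≤ n) : Prop :=
  ∃ lam : Fin m → ℝ,
    (block22 r h (∑ i, lam i • A i)).PosSemidef ∧
    ¬ colSpace (block12 r h (∑ i, lam i • A i))ᵀ ≤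
        colSpace (block22 r h (∑ i, lam i • A i))

/-- `padLow r h U = diag(0, U)` as an `n × n` matrix. -/
def padLow {n : ℕ} (r : ℕ) (h : r ≤ n) (U : Matrix (Fin (n - r)) (Fin (n - r)) ℝ) :
    Matrix (Fin n) (Fin n) ℝ :=
  Matrix.of fun a b =>
    if hab : r ≤ (a : ℕ) ∧ r ≤ (b : ℕ) then U ⟨a.1 - r, by omega⟩ ⟨b.1 - r, by omega⟩
    else 0

/-- "Good condition 1": some positive definite `U` has `Aᵢ • diag(0, U) = 0` for all `i`. -/
def GoodCond1 {n m : ℕ} (A : Fin m → Matrix (Fin n) (Fin n) ℝ) (r : ℕ) (h : r ≤ n) : Prop :=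
  ∃ U : Matrix (Fin (n - r)) (Fin (n - r)) ℝ, U.PosDef ∧ ∀ i, ip (A i) (padLow r h U) = 0

/-- "Good condition 2": every linear combination of the `Aᵢ` with zero lower-right
block has zero upper-right block. -/
def GoodCond2 {n m : ℕ} (A : Fin m → Matrix (Fin n) (Fin n) ℝ) (r : ℕ) (h : r ≤ n) : Prop :=
  ∀ lam : Fin m → ℝ, block22 r h (∑ i, lam i • A i) = 0 →
    block12 r h (∑ i, lam i • A i) = 0

/-- `Tmat r h N = [[I_r, 0], [0, N]]`. -/
def Tmat {n : ℕ} (r : ℕ) (h : r ≤ n) (N : Matrix (Fin (n - r)) (Fin (n - r)) ℝ) :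
    Matrix (Fin n) (Fin n) ℝ :=
  Matrix.of fun a b =>
    if (a : ℕ) < r ∧ (b : ℕ) < r then (if a = b then (1 : ℝ) else 0)
    else if hab : r ≤ (a : ℕ) ∧ r ≤ (b : ℕ) then N ⟨a.1 - r, by omega⟩ ⟨b.1 - r, by omega⟩
    else 0

/-- The system `∑ xᵢ A'ᵢ ⪯ B'` is an elementary reformulation of `∑ xᵢ Aᵢ ⪯ B`:
there are an invertible `M : ℝ^{m×m}`, a vector `μ ∈ ℝ^m` and an invertible
`T = [[I_r, 0], [0, N]]` with `A'ᵢ = Tᵀ (∑ⱼ Mᵢⱼ Aⱼ) T` and `B' = Tᵀ (B + ∑ⱼ μⱼ Aⱼ) T`. -/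
def ElemReform {n m : ℕ} (r : ℕ) (h : r ≤ n)
    (A : Fin m → Matrix (Fin n) (Fin n) ℝ) (B : Matrix (Fin n) (Fin n) ℝ)
    (A' : Fin m → Matrix (Fin n) (Fin n) ℝ) (B' : Matrix (Fin n) (Fin n) ℝ) : Prop :=
  ∃ (M : Matrix (Fin m) (Fin m) ℝ) (μ : Fin m → ℝ)
    (N : Matrix (Fin (n - r)) (Fin (n - r)) ℝ),
    IsUnit M ∧ IsUnit (Tmat r h N) ∧
    (∀ i, A' i = (Tmat r h N)ᵀ * (∑ j, M i j • A j) * Tmat r h N) ∧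
    B' = (Tmat r h N)ᵀ * (B + ∑ j, μ j • A j) * Tmat r h N

/-- The last `n - r` columns of a square matrix, as an `n × (n-r)` matrix. -/
def lastCols {n : ℕ} (r : ℕ) (h : r ≤ n) (V : Matrix (Fin n) (Fin n) ℝ) :
    Matrix (Fin n) (Fin (n - r)) ℝ :=
  Matrix.of fun a j => V a ⟨r + j.1, by omega⟩

/-- Bad normal form of a semidefinite system. -/
def BadNormalForm {n m : ℕ} (A : Fin m → Matrix (Fin n) (Fin n) ℝ)
    (B : Matrix (Fin n) (Fin n) ℝ) (r : ℕ) (h : r ≤ n) : Prop :=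
  B = Zmat n r ∧ MaxRankSlack A B r ∧
  ∃ k : ℕ, ∃ hk : k < m,
    (∀ i : Fin m, (i : ℕ) < k → ∀ a b : Fin n, r ≤ (b : ℕ) → A i a b = 0) ∧
    (∀ i : Fin m, (i : ℕ) < k → ∀ a b : Fin n, r ≤ (a : ℕ) → A i a b = 0) ∧
    LinearIndependent ℝ (fun i : Fin (m - k) => lastCols r h (A ⟨k + i.1, by omega⟩)) ∧
    (block22 r h (A ⟨m - 1, by omega⟩)).PosSemidef

/-- Good normal form of a semidefinite system. -/
def GoodNormalForm {n m : ℕ} (A : Fin m → Matrix (Fin n) (Fin n) ℝ)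
    (B : Matrix (Fin n) (Fin n) ℝ) (r : ℕ) (h : r ≤ n) : Prop :=
  B = Zmat n r ∧ MaxRankSlack A B r ∧
  ∃ k : ℕ, ∃ _hk : k ≤ m,
    (∀ i : Fin m, (i : ℕ) < k → ∀ a b : Fin n,
        (r ≤ (a : ℕ) ∨ r ≤ (b : ℕ)) → A i a b = 0) ∧
    LinearIndependent ℝ (fun i : Fin (m - k) => block22 r h (A ⟨k + i.1, by omega⟩)) ∧
    ∃ U : Matrix (Fin (n - r)) (Fin (n - r)) ℝ, U.PosDef ∧
      ∀ i : Fin m, k ≤ (i : ℕ) → ip (block22 r h (A i)) U = 0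

/-- The image of the positive semidefinite cone under `Y ↦ (A₁ • Y, …, A_m • Y)`. -/
def imageSet {n m : ℕ} (A : Fin m → Matrix (Fin n) (Fin n) ℝ) : Set (Fin m → ℝ) :=
  {y | ∃ Y : Matrix (Fin n) (Fin n) ℝ, Y.PosSemidef ∧ ∀ i, ip (A i) Y = y i}

theorem abs_dotProduct_mulVec_le {k : ℕ} (M : Matrix (Fin k) (Fin k) ℝ) (w : Fin k → ℝ) :
    |w ⬝ᵥ M *ᵥ w| ≤ (∑ i, ∑ j, |M i j|) * (w ⬝ᵥ w) := by
  have key : ∀ i j, |w i * w j| ≤ w ⬝ᵥ w := by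
    intro i j
    have h : ∀ i, w i * w i ≤ w ⬝ᵥ w := fun i =>
      Finset.single_le_sum (f := fun i => w i * w i) (fun i _ => mul_self_nonneg _)
        (Finset.mem_univ i)
    have hi := h i
    have hj := h j
    rw [abs_le]
    constructor <;> nlinarith [sq_nonneg (w i + w j), sq_nonneg (w i - w j)]
  have hq : w ⬝ᵥ M *ᵥ w = ∑ i, ∑ j, M i j * (w i * w j) := by
    simp only [dotProduct, mulVec, Finset.mul_sum]
    exact Finset.sum_congr rfl fun i _ => Finset.sum_congr rfl fun j _ => by ring
  rw [hq, Finset.sum_mul]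
  refine (Finset.abs_sum_le_sum_abs _ _).trans (Finset.sum_le_sum fun i _ => ?_)
  rw [Finset.sum_mul]
  refine (Finset.abs_sum_le_sum_abs _ _).trans (Finset.sum_le_sum fun j _ => ?_)
  rw [abs_mul]
  exact mul_le_mul_of_nonneg_left (key i j) (abs_nonneg _)

open scoped MatrixOrder in
theorem exists_posSemidef_add_smul {k : ℕ} {U W : Matrix (Fin k) (Fin k) ℝ} (hU : U.PosDef)
    (hW : W.IsSymm) : ∃ t : ℝ, (W + t • U).PosSemidef := by
  obtain ⟨C, hC, rfl⟩ : ∃ C : Matrix (Fin k) (Fin k) ℝ, IsUnit C ∧ U = Cᵀ * C := by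
    obtain ⟨C, hC, rfl⟩ := CStarAlgebra.isStrictlyPositive_iff_eq_star_mul_self.mp
      hU.isStrictlyPositive
    exact ⟨C, hC, by rw [star_eq_conjTranspose, conjTranspose_eq_transpose_of_trivial]⟩
  have hdet : IsUnit C.det := (Matrix.isUnit_iff_isUnit_det C).mp hC
  set W' := (C⁻¹)ᵀ * W * C⁻¹ with hW'
  refine ⟨∑ i, ∑ j, |W' i j|, ?_⟩
  have h : W + (∑ i, ∑ j, |W' i j|) • (Cᵀ * C)
      = Cᴴ * (W' + (∑ i, ∑ j, |W' i j|) • 1) * C := by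
    have h1 : Cᵀ * (C⁻¹)ᵀ = 1 := by rw [← transpose_mul, nonsing_inv_mul _ hdet, transpose_one]
    have h2 : Cᵀ * W' * C = W := by
      calc Cᵀ * W' * C = (Cᵀ * (C⁻¹)ᵀ) * W * (C⁻¹ * C) := by simp only [hW', Matrix.mul_assoc]
        _ = W := by rw [h1, nonsing_inv_mul _ hdet, Matrix.one_mul, Matrix.mul_one]
    rw [conjTranspose_eq_transpose_of_trivial, Matrix.mul_add, Matrix.add_mul, h2]
    simp
  rw [h]
  apply Matrix.PosSemidef.conjTranspose_mul_mul_same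
  apply Matrix.PosSemidef.of_dotProduct_mulVec_nonneg
  · rw [Matrix.IsHermitian, conjTranspose_eq_transpose_of_trivial]
    simp [hW', transpose_mul, hW.eq, Matrix.mul_assoc]
  · intro w
    have hb := (abs_le.mp (abs_dotProduct_mulVec_le W' w)).1
    simp only [star_trivial, add_mulVec, dotProduct_add, smul_mulVec, one_mulVec, dotProduct_smul,
      smul_eq_mul]
    linarith

theorem exists_comp_eq_of_ker_le {V W : Type*} [AddCommGroup V] [Module ℝ V] [AddCommGroup W]
    [Module ℝ W] (T : V →ₗ[ℝ] W) (φ : V →ₗ[ℝ] ℝ) (h : ∀ x, T x = 0 → φ x = 0) :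
    ∃ g : W →ₗ[ℝ] ℝ, ∀ x, g (T x) = φ x := by
  have : φ ∈ LinearMap.range T.dualMap := by
    rw [LinearMap.range_dualMap_eq_dualAnnihilator_ker, Submodule.mem_dualAnnihilator]
    exact fun x hx => h x hx
  obtain ⟨g, hg⟩ := this
  exact ⟨g, fun x => by rw [← hg]; rfl⟩

theorem exists_ip_eq {k : ℕ} (g : Matrix (Fin k) (Fin k) ℝ →ₗ[ℝ] ℝ) :
    ∃ Y : Matrix (Fin k) (Fin k) ℝ, Y.IsSymm ∧ (∀ M, M.IsSymm → ip M Y = g M) ∧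
      ∀ w, w ⬝ᵥ Y *ᵥ w = g (vecMulVec w w) := by
  have hg : ∀ M, g M = ∑ i, ∑ j, M i j * g (single i j 1) := by
    intro M
    conv_lhs => rw [matrix_eq_sum_single M]
    simp only [map_sum]
    refine Finset.sum_congr rfl fun i _ => Finset.sum_congr rfl fun j _ => ?_
    rw [← smul_eq_mul, ← map_smul, smul_single, smul_eq_mul, mul_one]
  refine ⟨of fun i j => (g (single i j 1) + g (single j i 1)) / 2, ?_, ?_, ?_⟩
  · ext i j
    simp [add_comm]
  · intro M hM
    have h1 : g M = ∑ i, ∑ j, M i j * g (single j i 1) := by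
      rw [hg M, Finset.sum_comm]
      simp_rw [fun i j => hM.apply i j]
    have h2 : g M = (g M + g M) / 2 := by ring
    rw [h2]
    nth_rw 1 [hg M]
    rw [h1, ip, Matrix.trace, ← Finset.sum_add_distrib, Finset.sum_div]
    refine Finset.sum_congr rfl fun i _ => ?_
    rw [diag_apply, mul_apply, ← Finset.sum_add_distrib, Finset.sum_div]
    refine Finset.sum_congr rfl fun j _ => ?_
    rw [of_apply]
    ring
  · intro w
    have h1 : g (vecMulVec w w) = ∑ i, ∑ j, vecMulVec w w i j * g (single j i 1) := by
      rw [hg, Finset.sum_comm]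
      simp_rw [vecMulVec_apply, mul_comm]
    have h2 : g (vecMulVec w w) = (g (vecMulVec w w) + g (vecMulVec w w)) / 2 := by ring
    rw [h2]
    nth_rw 1 [hg (vecMulVec w w)]
    rw [h1, dotProduct, ← Finset.sum_add_distrib, Finset.sum_div]
    refine Finset.sum_congr rfl fun i _ => ?_
    rw [mulVec, dotProduct, Finset.mul_sum, ← Finset.sum_add_distrib, Finset.sum_div]
    refine Finset.sum_congr rfl fun j _ => ?_
    rw [of_apply, vecMulVec_apply]
    ring

theorem ip_add_right {k : ℕ} (S T T' : Matrix (Fin k) (Fin k) ℝ) :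
    ip S (T + T') = ip S T + ip S T' := by
  simp [ip, Matrix.mul_add]

theorem ip_smul_right {k : ℕ} (S T : Matrix (Fin k) (Fin k) ℝ) (t : ℝ) :
    ip S (t • T) = t * ip S T := by
  simp [ip]

theorem ip_sub_left {k : ℕ} (S S' T : Matrix (Fin k) (Fin k) ℝ) :
    ip (S - S') T = ip S T - ip S' T := by
  simp [ip, Matrix.sub_mul]

theorem ip_sum_smul_left {k m : ℕ} (A : Fin m → Matrix (Fin k) (Fin k) ℝ) (x : Fin m → ℝ)
    (T : Matrix (Fin k) (Fin k) ℝ) : ip (∑ i, x i • A i) T = ∑ i, x i * ip (A i) T := by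
  simp [ip, Finset.sum_mul, Matrix.trace_sum]

theorem sum_eq_sum_low {n r : ℕ} (h : r ≤ n) (f : Fin n → ℝ)
    (hf : ∀ a : Fin n, (a : ℕ) < r → f a = 0) :
    ∑ a, f a = ∑ j : Fin (n - r), f ⟨r + j.1, by omega⟩ := by
  symm
  refine Finset.sum_of_injOn (fun j : Fin (n - r) => (⟨r + j.1, by omega⟩ : Fin n)) ?_ ?_ ?_ ?_
  · intro i _ j _ hij
    simp only [Fin.mk.injEq] at hij
    ext
    omega
  · simp
  · intro a _ ha
    apply hf
    by_contra hlt
    exact ha ⟨⟨a.1 - r, by omega⟩, by simp, by ext; simp; omega⟩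
  · simp

theorem ip_padLow {n r : ℕ} (h : r ≤ n) (M : Matrix (Fin n) (Fin n) ℝ)
    (U : Matrix (Fin (n - r)) (Fin (n - r)) ℝ) :
    ip M (padLow r h U) = ip (block22 r h M) U := by
  rw [ip, ip, Matrix.trace, Matrix.trace, sum_eq_sum_low h]
  · refine Finset.sum_congr rfl fun i _ => ?_
    rw [diag_apply, diag_apply, mul_apply, mul_apply, sum_eq_sum_low h]
    · refine Finset.sum_congr rfl fun j _ => ?_
      simp [padLow, block22]
    · intro a ha
      simp [padLow, show ¬ r ≤ (a : ℕ) by omega]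
  · intro a ha
    rw [diag_apply, mul_apply]
    exact Finset.sum_eq_zero fun b _ => by simp [padLow, show ¬ r ≤ (a : ℕ) by omega]

theorem padLow_add {n r : ℕ} (h : r ≤ n) (U U' : Matrix (Fin (n - r)) (Fin (n - r)) ℝ) :
    padLow r h (U + U') = padLow r h U + padLow r h U' := by
  ext a b
  simp only [padLow, of_apply, Matrix.add_apply]
  split_ifs <;> simp

theorem posSemidef_padLow {n r : ℕ} (h : r ≤ n) {U : Matrix (Fin (n - r)) (Fin (n - r)) ℝ}
    (hU : U.PosSemidef) : (padLow r h U).PosSemidef := by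
  apply Matrix.PosSemidef.of_dotProduct_mulVec_nonneg
  · ext a b
    simp only [conjTranspose_apply, padLow, of_apply, star_trivial]
    by_cases hab : r ≤ (a : ℕ) ∧ r ≤ (b : ℕ)
    · rw [dif_pos hab, dif_pos hab.symm]
      exact hU.isHermitian.apply _ _
    · rw [dif_neg hab, dif_neg (fun h => hab h.symm)]
  · intro w
    have hq := hU.dotProduct_mulVec_nonneg (fun j => w ⟨r + j.1, by omega⟩)
    simp only [star_trivial] at hq ⊢
    refine hq.trans_eq ?_
    rw [dotProduct, dotProduct, sum_eq_sum_low h]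
    · refine Finset.sum_congr rfl fun i _ => ?_
      rw [mulVec, mulVec, dotProduct, dotProduct, sum_eq_sum_low h]
      · simp [padLow]
      · intro a ha
        simp [padLow, show ¬ r ≤ (a : ℕ) by omega]
    · intro a ha
      simp [padLow, mulVec, dotProduct, show ¬ r ≤ (a : ℕ) by omega]

theorem Zmat_eq_diagonal (n r : ℕ) :
    Zmat n r = diagonal fun i : Fin n => if (i : ℕ) < r then (1 : ℝ) else 0 := by
  ext i j
  by_cases hij : i = j <;> simp [Zmat, hij]

theorem posSemidef_Zmat (n r : ℕ) : (Zmat n r).PosSemidef := by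
  rw [Zmat_eq_diagonal]
  refine PosSemidef.diagonal fun i => ?_
  dsimp
  split_ifs <;> simp

theorem rank_Zmat {n r : ℕ} (h : r ≤ n) : (Zmat n r).rank = r := by
  rw [Zmat_eq_diagonal, Matrix.rank_diagonal]
  simp [Fintype.card_subtype, Fin.card_filter_val_lt, h]

/-- The last `n - r` columns of every slack vanish. -/
theorem slack_apply_eq_zero_of_right {n m : ℕ} {A : Fin m → Matrix (Fin n) (Fin n) ℝ}
    {B : Matrix (Fin n) (Fin n) ℝ} {r : ℕ} (hr : r ≤ n) (hZ : MaxRankSlack A B r)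
    {x : Fin m → ℝ} (hx : IsFeasible A B x) (a b : Fin n) (hb : r ≤ (b : ℕ)) :
    (B - ∑ i, x i • A i) a b = 0 := by
  obtain ⟨⟨x₀, hx₀⟩, hmax⟩ := hZ
  set S := B - ∑ i, x i • A i with hS
  have hSp : S.PosSemidef := hx
  set N := (1 / 2 : ℝ) • Zmat n r + (1 / 2 : ℝ) • S with hN
  have hmid : B - ∑ i, ((1 / 2 : ℝ) • x₀ + (1 / 2 : ℝ) • x) i • A i = N := by
    rw [hN, hS, ← hx₀]
    simp only [Pi.add_apply, Pi.smul_apply, add_smul, smul_assoc, Finset.sum_add_distrib,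
      ← Finset.smul_sum]
    module
  have hNp : N.PosSemidef :=
    ((posSemidef_Zmat n r).smul (by norm_num)).add (hSp.smul (by norm_num))
  have hrank : N.rank ≤ r := by
    rw [← hmid]
    refine hmax _ ?_
    rw [IsFeasible, hmid]
    exact hNp
  have hker : ∀ w, N *ᵥ w = 0 → Zmat n r *ᵥ w = 0 ∧ S *ᵥ w = 0 := by
    intro w hw
    have h0 : star w ⬝ᵥ N *ᵥ w = 0 := by rw [hw, dotProduct_zero]
    have h1 := (posSemidef_Zmat n r).dotProduct_mulVec_nonneg w
    have h2 := hSp.dotProduct_mulVec_nonneg w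
    simp only [hN, add_mulVec, smul_mulVec, dotProduct_add, dotProduct_smul, smul_eq_mul] at h0
    exact ⟨((posSemidef_Zmat n r).dotProduct_mulVec_zero_iff w).mp (by linarith),
      (hSp.dotProduct_mulVec_zero_iff w).mp (by linarith)⟩
  have hle : LinearMap.ker N.mulVecLin ≤ LinearMap.ker (Zmat n r).mulVecLin :=
    fun w hw => (hker w hw).1
  have hfin : Module.finrank ℝ (LinearMap.ker (Zmat n r).mulVecLin)
      ≤ Module.finrank ℝ (LinearMap.ker N.mulVecLin) := by
    have h1 := LinearMap.finrank_range_add_finrank_ker N.mulVecLin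
    have h2 := LinearMap.finrank_range_add_finrank_ker (Zmat n r).mulVecLin
    have h3 := rank_Zmat hr
    rw [Matrix.rank] at h3 hrank
    omega
  have heq := Submodule.eq_of_le_of_finrank_le hle hfin
  have hmem : Pi.single b (1 : ℝ) ∈ LinearMap.ker (Zmat n r).mulVecLin := by
    rw [LinearMap.mem_ker, mulVecLin_apply, mulVec_single_one]
    ext i
    simp only [col_apply, Zmat, of_apply, Pi.zero_apply, ite_eq_right_iff]
    rintro ⟨rfl, h⟩
    omega
  rw [← heq] at hmem
  have := congrFun (hker _ hmem).2 a
  rwa [mulVec_single_one] at this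

/-- Every slack vanishes outside the upper-left block. -/
theorem slack_apply_eq_zero {n m : ℕ} {A : Fin m → Matrix (Fin n) (Fin n) ℝ}
    {B : Matrix (Fin n) (Fin n) ℝ} {r : ℕ} (hr : r ≤ n) (hZ : MaxRankSlack A B r)
    {x : Fin m → ℝ} (hx : IsFeasible A B x) (a b : Fin n)
    (hab : r ≤ (a : ℕ) ∨ r ≤ (b : ℕ)) : (B - ∑ i, x i • A i) a b = 0 := by
  rcases hab with h | h
  · rw [← Matrix.IsHermitian.apply (PosSemidef.isHermitian hx),
      slack_apply_eq_zero_of_right hr hZ hx b a h, star_zero]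
  · exact slack_apply_eq_zero_of_right hr hZ hx a b h

theorem isFeasible_of_slack_eq_Zmat {n m : ℕ} {A : Fin m → Matrix (Fin n) (Fin n) ℝ}
    {B : Matrix (Fin n) (Fin n) ℝ} {r : ℕ} {x : Fin m → ℝ}
    (hx : B - ∑ i, x i • A i = Zmat n r) : IsFeasible A B x := by
  rw [IsFeasible, hx]
  exact posSemidef_Zmat n r

theorem padLow_block22 {n r : ℕ} (h : r ≤ n) {Y : Matrix (Fin n) (Fin n) ℝ}
    (hY : ∀ a b : Fin n, (a : ℕ) < r ∨ (b : ℕ) < r → Y a b = 0) :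
    padLow r h (block22 r h Y) = Y := by
  ext a b
  by_cases hab : r ≤ (a : ℕ) ∧ r ≤ (b : ℕ)
  · simp [padLow, block22, hab]
  · rw [hY a b (by omega)]
    simp [padLow, hab]

theorem ip_Zmat {n r : ℕ} (Y : Matrix (Fin n) (Fin n) ℝ) :
    ip (Zmat n r) Y = ∑ a : Fin n, if (a : ℕ) < r then Y a a else 0 := by
  simp [ip, Matrix.trace, Zmat_eq_diagonal, ite_mul]

theorem apply_eq_zero_of_ip_Zmat_eq_zero {n r : ℕ} {Y : Matrix (Fin n) (Fin n) ℝ}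
    (hY : Y.PosSemidef) (h0 : ip (Zmat n r) Y = 0) (a b : Fin n)
    (hab : (a : ℕ) < r ∨ (b : ℕ) < r) : Y a b = 0 := by
  have key : ∀ a b : Fin n, (b : ℕ) < r → Y a b = 0 := by
    intro a b hb
    rw [ip_Zmat, Finset.sum_eq_zero_iff_of_nonneg] at h0
    · have hbb := h0 b (Finset.mem_univ _)
      rw [if_pos hb] at hbb
      have h1 : Y *ᵥ Pi.single b 1 = 0 := by
        rw [← hY.dotProduct_mulVec_zero_iff]
        simp [hbb]
      simpa [mulVec_single_one] using congrFun h1 a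
    · intro i _
      split_ifs
      exacts [hY.diag_nonneg, le_rfl]
  rcases hab with h | h
  · rw [← hY.isHermitian.apply, key b a h, star_zero]
  · exact key a b h

/-- In a well behaved system, the constraint values of a matrix with zero upper-left block are
attained at a positive semidefinite matrix supported on the lower-right block. -/
theorem exists_posSemidef_low {n m : ℕ} {A : Fin m → Matrix (Fin n) (Fin n) ℝ}
    {B : Matrix (Fin n) (Fin n) ℝ} {r : ℕ} (hr : r ≤ n) (hZ : MaxRankSlack A B r)
    (hwb : ¬ BadlyBehaved A B) (Y : Matrix (Fin n) (Fin n) ℝ)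
    (hY : ∀ a b : Fin n, (a : ℕ) < r → (b : ℕ) < r → Y a b = 0) :
    ∃ Q : Matrix (Fin (n - r)) (Fin (n - r)) ℝ, Q.PosSemidef ∧
      ∀ i, ip (A i) (padLow r hr Q) = ip (A i) Y := by
  have hS : ∀ x, IsFeasible A B x → ip B Y = ∑ i, ip (A i) Y * x i := by
    intro x hx
    have h0 : ip (B - ∑ i, x i • A i) Y = 0 := by
      rw [ip, Matrix.trace]
      refine Finset.sum_eq_zero fun a _ => ?_
      rw [diag_apply, mul_apply]
      refine Finset.sum_eq_zero fun b _ => ?_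
      by_cases hab : r ≤ (a : ℕ) ∨ r ≤ (b : ℕ)
      · rw [slack_apply_eq_zero hr hZ hx a b hab, zero_mul]
      · rw [hY b a (by omega) (by omega), mul_zero]
    rw [ip_sub_left, ip_sum_smul_left] at h0
    simp_rw [mul_comm (ip _ _)]
    linarith
  obtain ⟨x₀, hx₀⟩ := hZ.1
  have hf := isFeasible_of_slack_eq_Zmat hx₀
  have hlub : IsLUB (PrimalVals A B fun i => ip (A i) Y) (ip B Y) := by
    have : PrimalVals A B (fun i => ip (A i) Y) = {ip B Y} := by
      ext s
      constructor
      · rintro ⟨x, hx, rfl⟩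
        exact (hS x hx).symm
      · rintro rfl
        exact ⟨x₀, hf, hS x₀ hf⟩
    rw [this]
    exact isLUB_singleton
  obtain ⟨Y', hY', hc, hv⟩ := not_not.mp fun h => hwb ⟨_, _, hlub, h⟩
  have hZ0 : ip (Zmat n r) Y' = 0 := by
    rw [← hx₀, ip_sub_left, ip_sum_smul_left, hv, hS x₀ hf]
    simp [hc, mul_comm]
  refine ⟨block22 r hr Y', hY'.submatrix _, ?_⟩
  rwa [padLow_block22 hr (apply_eq_zero_of_ip_Zmat_eq_zero hY' hZ0)]

theorem goodCond1_of_wellBehaved {n m : ℕ} {A : Fin m → Matrix (Fin n) (Fin n) ℝ}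
    {B : Matrix (Fin n) (Fin n) ℝ} {r : ℕ} (hr : r ≤ n) (hZ : MaxRankSlack A B r)
    (hwb : ¬ BadlyBehaved A B) : GoodCond1 A r hr := by
  obtain ⟨Q, hQ, h⟩ := exists_posSemidef_low hr hZ hwb (-padLow r hr 1) (by
    intro a b ha _
    simp [padLow, show ¬ r ≤ (a : ℕ) by omega])
  refine ⟨Q + 1, PosDef.posSemidef_add hQ PosDef.one, fun i => ?_⟩
  rw [padLow_add, ip_add_right, h i]
  simp [ip]

theorem goodCond2_of_wellBehaved {n m : ℕ} {A : Fin m → Matrix (Fin n) (Fin n) ℝ}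
    {B : Matrix (Fin n) (Fin n) ℝ} {r : ℕ} (hr : r ≤ n) (hZ : MaxRankSlack A B r)
    (hwb : ¬ BadlyBehaved A B) : GoodCond2 A r hr := by
  intro lam h22
  ext a j
  obtain ⟨Q, hQ, h⟩ := exists_posSemidef_low hr hZ hwb
    (single (⟨r + j.1, by omega⟩ : Fin n) (⟨a.1, by omega⟩ : Fin n) (1 : ℝ)) (by
      intro b c hb _
      rw [single_apply, if_neg]
      rintro ⟨rfl, -⟩
      simp at hb)
  have h1 : ip (∑ i, lam i • A i) (padLow r hr Q) = 0 := by
    rw [ip_padLow, h22]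
    simp [ip]
  rw [ip_sum_smul_left] at h1
  simp_rw [h] at h1
  rw [← ip_sum_smul_left] at h1
  simpa [ip, trace_mul_single, block12] using h1

/-- Matrices whose upper-left block has nonnegative quadratic form. -/
def upperLeftCone (n r : ℕ) : PointedCone ℝ (Matrix (Fin n) (Fin n) ℝ) where
  carrier := {M | ∀ w, 0 ≤ (Zmat n r *ᵥ w) ⬝ᵥ M *ᵥ (Zmat n r *ᵥ w)}
  add_mem' := by
    intro M N hM hN w
    rw [add_mulVec, dotProduct_add]
    exact add_nonneg (hM w) (hN w)
  zero_mem' := by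
    intro w
    simp
  smul_mem' := by
    rintro ⟨c, hc⟩ M hM w
    change 0 ≤ _ ⬝ᵥ (c • M) *ᵥ _
    rw [smul_mulVec, dotProduct_smul]
    exact mul_nonneg hc (hM w)

theorem Zmat_mulVec_Zmat_mulVec {n r : ℕ} (w : Fin n → ℝ) :
    Zmat n r *ᵥ (Zmat n r *ᵥ w) = Zmat n r *ᵥ w := by
  ext i
  simp only [Zmat_eq_diagonal, mulVec_diagonal]
  split_ifs <;> simp

theorem posSemidef_of_mem_upperLeftCone {n r : ℕ} {M : Matrix (Fin n) (Fin n) ℝ}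
    (hM : M ∈ upperLeftCone n r) (hs : M.IsSymm)
    (h0 : ∀ a b : Fin n, r ≤ (b : ℕ) → M a b = 0) : M.PosSemidef := by
  have hMZ : M * Zmat n r = M := by
    ext a b
    rw [Zmat_eq_diagonal, mul_diagonal]
    split_ifs with h
    · rw [mul_one]
    · rw [h0 a b (by omega), mul_zero]
  have hZM : Zmat n r * M = M := by
    have := congrArg transpose hMZ
    rwa [transpose_mul, hs.eq, Zmat_eq_diagonal, diagonal_transpose, ← Zmat_eq_diagonal] at this
  apply PosSemidef.of_dotProduct_mulVec_nonneg
  · rwa [Matrix.IsHermitian, conjTranspose_eq_transpose_of_trivial]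
  · intro w
    have hw := hM w
    rw [mulVec_mulVec, hMZ, ← vecMul_transpose, ← dotProduct_mulVec, mulVec_mulVec,
      Zmat_eq_diagonal, diagonal_transpose, ← Zmat_eq_diagonal, hZM] at hw
    simpa using hw

theorem exists_smul_Zmat_add_mem {n r : ℕ} (M : Matrix (Fin n) (Fin n) ℝ) :
    ∃ t : ℝ, t • Zmat n r + M ∈ upperLeftCone n r := by
  refine ⟨∑ i, ∑ j, |M i j|, fun w => ?_⟩
  have hb := (abs_le.mp (abs_dotProduct_mulVec_le M (Zmat n r *ᵥ w))).1
  rw [add_mulVec, smul_mulVec, Zmat_mulVec_Zmat_mulVec, dotProduct_add, dotProduct_smul,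
    smul_eq_mul]
  linarith

/-- The linear map `x ↦ ∑ xᵢ Aᵢ`. -/
noncomputable def combination {n m : ℕ} (A : Fin m → Matrix (Fin n) (Fin n) ℝ) :
    (Fin m → ℝ) →ₗ[ℝ] Matrix (Fin n) (Fin n) ℝ :=
  Fintype.linearCombination ℝ A

theorem combination_apply {n m : ℕ} (A : Fin m → Matrix (Fin n) (Fin n) ℝ) (x : Fin m → ℝ) :
    combination A x = ∑ i, x i • A i :=
  Fintype.linearCombination_apply ℝ A x

theorem isSymm_combination {n m : ℕ} {A : Fin m → Matrix (Fin n) (Fin n) ℝ}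
    (hA : ∀ i, (A i).IsSymm) (x : Fin m → ℝ) : (combination A x).IsSymm := by
  rw [combination_apply, Matrix.IsSymm, transpose_sum]
  exact Finset.sum_congr rfl fun i _ => by rw [transpose_smul, (hA i).eq]

/-- The linear map taking a matrix to its lower-right block. -/
def block22Linear {n : ℕ} (r : ℕ) (h : r ≤ n) :
    Matrix (Fin n) (Fin n) ℝ →ₗ[ℝ] Matrix (Fin (n - r)) (Fin (n - r)) ℝ where
  toFun := block22 r h
  map_add' _ _ := rfl
  map_smul' _ _ := rfl

theorem isSymm_Zmat (n r : ℕ) : (Zmat n r).IsSymm := by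
  rw [Zmat_eq_diagonal]
  exact isSymm_diagonal _

/-- Homogenized form of the bound `c ⬝ x ≤ v` over the feasible set. -/
theorem dotProduct_le_of_mem_upperLeftCone {n m : ℕ} {A : Fin m → Matrix (Fin n) (Fin n) ℝ}
    {B : Matrix (Fin n) (Fin n) ℝ} (hA : ∀ i, (A i).IsSymm) {r : ℕ} (hr : r ≤ n)
    (hZ : MaxRankSlack A B r) (hG : GoodCond2 A r hr) {c : Fin m → ℝ} {v : ℝ}
    (hlub : IsLUB (PrimalVals A B c) v) {x₀ : Fin m → ℝ}
    (hx₀ : B - combination A x₀ = Zmat n r) (t : ℝ) (lam : Fin m → ℝ)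
    (hlam : block22 r hr (combination A lam) = 0)
    (hmem : t • Zmat n r - combination A lam ∈ upperLeftCone n r) :
    c ⬝ᵥ lam ≤ t * (v - c ⬝ᵥ x₀) := by
  have hone : ∀ mu, block22 r hr (combination A mu) = 0 →
      Zmat n r - combination A mu ∈ upperLeftCone n r → c ⬝ᵥ mu ≤ v - c ⬝ᵥ x₀ := by
    intro mu hmu hmem
    have hslack : B - combination A (x₀ + mu) = Zmat n r - combination A mu := by
      rw [map_add, ← hx₀]
      abel
    have hfeas : IsFeasible A B (x₀ + mu) := by
      rw [IsFeasible, ← combination_apply, hslack]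
      refine posSemidef_of_mem_upperLeftCone hmem ?_ ?_
      · exact (isSymm_Zmat n r).sub (isSymm_combination hA mu)
      · intro a b hb
        have h12 : block12 r hr (combination A mu) = 0 := by
          rw [combination_apply] at hmu ⊢
          exact hG mu hmu
        have hzero : Zmat n r a b = 0 := by
          simp only [Zmat, of_apply, ite_eq_right_iff]
          rintro ⟨rfl, h⟩
          omega
        rw [Matrix.sub_apply, hzero, zero_sub, neg_eq_zero]
        obtain ⟨b, hb'⟩ := b
        obtain ⟨j, rfl⟩ := Nat.exists_eq_add_of_le hb
        by_cases ha : (a : ℕ) < r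
        · exact congrFun (congrFun h12 ⟨a, ha⟩) ⟨j, by omega⟩
        · obtain ⟨a, ha'⟩ := a
          obtain ⟨i, rfl⟩ := Nat.exists_eq_add_of_le (not_lt.mp ha)
          exact congrFun (congrFun hmu ⟨i, by omega⟩) ⟨j, by omega⟩
    have := hlub.1 ⟨x₀ + mu, hfeas, rfl⟩
    change c ⬝ᵥ (x₀ + mu) ≤ v at this
    rw [dotProduct_add] at this
    linarith
  have hblock : ∀ (s : ℝ) (x y : Fin m → ℝ), block22 r hr (combination A x) = 0 →
      block22 r hr (combination A y) = 0 → block22 r hr (combination A (x + s • y)) = 0 := by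
    intro s x y hx hy
    change block22Linear r hr _ = 0 at hx hy ⊢
    rw [map_add, map_add, map_smul, map_smul, hx, hy, smul_zero, add_zero]
  rcases lt_or_ge 0 t with ht | ht
  · have h := hone (t⁻¹ • lam) (by
      have := hblock t⁻¹ 0 lam (by rw [map_zero]; rfl) hlam
      rwa [zero_add] at this) (by
      have := (upperLeftCone n r).smul_mem (inv_nonneg.mpr ht.le) hmem
      convert this using 1
      rw [smul_sub, smul_smul, inv_mul_cancel₀ ht.ne', one_smul, map_smul])
    rw [dotProduct_smul, smul_eq_mul, inv_mul_le_iff₀ ht] at h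
    exact h
  · have hpos : 0 < 1 - t := by linarith
    have hbound : v ≤ c ⬝ᵥ x₀ + (v - c ⬝ᵥ x₀ - c ⬝ᵥ lam) / (1 - t) := by
      refine hlub.2 ?_
      rintro _ ⟨x, hx, rfl⟩
      change c ⬝ᵥ x ≤ _
      have hslack : Zmat n r - combination A (x - x₀) = B - combination A x := by
        rw [map_sub, ← hx₀]
        abel
      have hb0 : block22 r hr (combination A (x - x₀)) = 0 := by
        have h : combination A (x - x₀) = Zmat n r - (B - combination A x) := by
          rw [← hslack, sub_sub_cancel]
        rw [h, ← hx₀, combination_apply, combination_apply]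
        ext i j
        change _ - (B - ∑ i, x i • A i) _ _ = (0 : ℝ)
        rw [slack_apply_eq_zero_of_right hr hZ hx _ _ (by simp), sub_zero]
        exact slack_apply_eq_zero_of_right hr hZ
          (isFeasible_of_slack_eq_Zmat (by rw [← combination_apply, hx₀])) _ _ (by simp)
      have h := hone (lam + (1 - t) • (x - x₀)) (hblock _ _ _ hlam hb0) (by
        have hS : B - combination A x ∈ upperLeftCone n r := by
          intro w
          rw [combination_apply]
          simpa using PosSemidef.dotProduct_mulVec_nonneg hx (Zmat n r *ᵥ w)
        have := (upperLeftCone n r).add_mem hmem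
          ((upperLeftCone n r).smul_mem hpos.le hS)
        convert this using 1
        rw [← hslack, map_add, map_smul]
        module)
      rw [dotProduct_add, dotProduct_smul, dotProduct_sub, smul_eq_mul] at h
      rw [← sub_le_iff_le_add', le_div_iff₀ hpos]
      linarith
    rw [← sub_le_iff_le_add', le_div_iff₀ hpos] at hbound
    linarith

theorem wellBehaved_of_goodConds {n m : ℕ} {A : Fin m → Matrix (Fin n) (Fin n) ℝ}
    {B : Matrix (Fin n) (Fin n) ℝ} (hA : ∀ i, (A i).IsSymm) {r : ℕ} (hr : r ≤ n)
    (hZ : MaxRankSlack A B r) (hG₁ : GoodCond1 A r hr) (hG₂ : GoodCond2 A r hr) :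
    ¬ BadlyBehaved A B := by
  rintro ⟨c, v, hlub, hno⟩
  apply hno
  obtain ⟨x₀, hx₀⟩ := hZ.1
  obtain ⟨U, hU, hAU⟩ := hG₁
  rw [← combination_apply] at hx₀
  let T := block22Linear r hr ∘ₗ combination A
  let Φ : ℝ × LinearMap.ker T →ₗ[ℝ] Matrix (Fin n) (Fin n) ℝ :=
    (LinearMap.toSpanSingleton ℝ _ (Zmat n r)).coprod (-(combination A ∘ₗ Submodule.subtype _))
  let cdot : (Fin m → ℝ) →ₗ[ℝ] ℝ := dotProductBilin ℝ ℝ c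
  let ψ : ℝ × LinearMap.ker T →ₗ[ℝ] ℝ :=
    (LinearMap.toSpanSingleton ℝ _ (v - c ⬝ᵥ x₀)).coprod (-(cdot ∘ₗ Submodule.subtype _))
  have hΦ : ∀ t lam, Φ (t, lam) = t • Zmat n r - combination A lam := fun t lam => by
    simp [Φ, sub_eq_add_neg]
  have hψ : ∀ t lam, ψ (t, lam) = t * (v - c ⬝ᵥ x₀) - c ⬝ᵥ lam := fun t lam => by
    simp [ψ, cdot, sub_eq_add_neg]
  have hnonneg : ∀ p, Φ p ∈ upperLeftCone n r → 0 ≤ ψ p := by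
    rintro ⟨t, lam, hlam⟩ hp
    rw [hΦ] at hp
    rw [hψ, sub_nonneg]
    exact dotProduct_le_of_mem_upperLeftCone hA hr hZ hG₂ hlub hx₀ t lam hlam hp
  obtain ⟨f, hf⟩ := exists_comp_eq_of_ker_le Φ ψ (fun p hp => by
    have h1 := hnonneg p (by rw [hp]; exact zero_mem _)
    have h2 := hnonneg (-p) (by rw [map_neg, hp, neg_zero]; exact zero_mem _)
    rw [map_neg] at h2
    linarith)
  obtain ⟨g, hgf, hg⟩ := riesz_extension (upperLeftCone n r)
    ⟨LinearMap.range Φ, f.domRestrict _⟩ (by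
      rintro ⟨_, p, rfl⟩ hp
      change 0 ≤ f (Φ p)
      rw [hf]
      exact hnonneg p hp) (by
      intro M
      obtain ⟨t, ht⟩ := exists_smul_Zmat_add_mem (r := r) M
      refine ⟨⟨t • Zmat n r, (t, 0), ?_⟩, ht⟩
      rw [hΦ]
      simp)
  have hgΦ : ∀ p, g (Φ p) = ψ p := fun p => by
    rw [← hf]
    exact hgf ⟨Φ p, p, rfl⟩
  obtain ⟨Y, hYs, hYg, hYq⟩ := exists_ip_eq g
  have hY : Y.PosSemidef := by
    apply PosSemidef.of_dotProduct_mulVec_nonneg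
    · rwa [Matrix.IsHermitian, conjTranspose_eq_transpose_of_trivial]
    · intro w
      rw [star_trivial, hYq]
      refine hg _ fun u => ?_
      rw [vecMulVec_mulVec, op_smul_eq_smul, dotProduct_smul, smul_eq_mul,
        dotProduct_comm w]
      exact mul_self_nonneg _
  obtain ⟨k, hk⟩ := exists_comp_eq_of_ker_le T (cdot - g ∘ₗ combination A) (fun lam hlam => by
    have h := hgΦ (0, ⟨lam, hlam⟩)
    rw [hΦ, hψ] at h
    simp only [zero_smul, zero_sub, zero_mul, map_neg] at h
    simp only [LinearMap.sub_apply, LinearMap.comp_apply]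
    change c ⬝ᵥ lam - _ = 0
    linarith)
  obtain ⟨W, hWs, hWk, -⟩ := exists_ip_eq k
  obtain ⟨t, ht⟩ := exists_posSemidef_add_smul hU hWs
  have hsum : ∀ i, ip (A i) (Y + padLow r hr (W + t • U)) = c i := by
    intro i
    have hi : combination A (Pi.single i 1) = A i := by
      rw [combination_apply]
      simp [Pi.single_apply]
    have h1 := hk (Pi.single i 1)
    simp only [T, cdot, LinearMap.sub_apply, LinearMap.comp_apply, hi] at h1
    change k (block22 r hr (A i)) = c ⬝ᵥ Pi.single i 1 - _ at h1
    rw [dotProduct_single_one] at h1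
    have hs : (block22 r hr (A i)).IsSymm := by
      ext a b
      exact (hA i).apply _ _
    have h2 := hAU i
    rw [ip_padLow] at h2
    rw [ip_add_right, ip_padLow, ip_add_right, ip_smul_right, h2, hWk _ hs, hYg _ (hA i), h1]
    ring
  have hZsum : ip (Zmat n r) (Y + padLow r hr (W + t • U)) = v - c ⬝ᵥ x₀ := by
    have h := hgΦ (1, 0)
    rw [hΦ, hψ] at h
    simp only [one_smul, ZeroMemClass.coe_zero, map_zero, sub_zero, dotProduct_zero, one_mul] at h
    have h0 : ip (Zmat n r) (padLow r hr (W + t • U)) = 0 := by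
      rw [ip_Zmat]
      refine Finset.sum_eq_zero fun a _ => ?_
      split_ifs with ha
      · simp [padLow, show ¬ r ≤ (a : ℕ) by omega]
      · rfl
    rw [ip_add_right, h0, hYg _ (isSymm_Zmat n r), h, add_zero]
  refine ⟨Y + padLow r hr (W + t • U), hY.add (posSemidef_padLow hr ht), hsum, ?_⟩
  rw [← hx₀, ip_sub_left, combination_apply, ip_sum_smul_left] at hZsum
  simp_rw [hsum] at hZsum
  have hcomm : ∑ i, x₀ i * c i = c ⬝ᵥ x₀ := dotProduct_comm x₀ c
  linarith

/-- Under the maximum rank slack assumption, the feasible system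
`∑ xᵢ Aᵢ ⪯ B` is well behaved iff both "Good conditions" hold. -/
theorem stmt1 {n m : ℕ} (hn : 0 < n) (hm : 0 < m)
    (A : Fin m → Matrix (Fin n) (Fin n) ℝ) (B : Matrix (Fin n) (Fin n) ℝ)
    (hA : ∀ i, (A i).IsSymm) (hB : B.IsSymm)
    (hfeas : ∃ x : Fin m → ℝ, IsFeasible A B x)
    (r : ℕ) (hr : r ≤ n) (hZ : MaxRankSlack A B r) :
    ¬ BadlyBehaved A B ↔ GoodCond1 A r hr ∧ GoodCond2 A r hr := by
  exact ⟨fun h => ⟨goodCond1_of_wellBehaved hr hZ h, goodCond2_of_wellBehaved hr hZ h⟩,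
    fun h => wellBehaved_of_goodConds hA hr hZ h.1 h.2⟩
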